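/- Let f : ℝ⁶ → ℝ be a function and p ∈ ℝ⁶. If f(p) > 0 then there is a linear isomorphism g of ℝ⁶ with g*(ω^f_p) = α_(i); if f(p) < 0 then there is a linear isomorphism g with g*(ω^f_p) = α_(ii); and if f(p) = 0 then there is a linear isomorphism g with g*(ω^f_p) = α_(iii). -/

import Mathlib

/-- `dx3 i j k` is the alternating 3-form `dxⁱ ∧ dxʲ ∧ dxᵏ` on `ℝ⁶ = Fin 6 → ℝ`. -/
noncomputable def dx3 (i j k : Fin 6) : AlternatingMap ℝ (Fin 6 → ℝ) ℝ (Fin 3) :=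
  (Matrix.detRowAlternating : AlternatingMap ℝ (Fin 3 → ℝ) ℝ (Fin 3)).compLinearMap
    (LinearMap.funLeft ℝ ℝ ![i, j, k])

/-- `α_(i) = dx^{123} + dx^{456}`. -/
noncomputable def alphaI : AlternatingMap ℝ (Fin 6 → ℝ) ℝ (Fin 3) :=
  dx3 0 1 2 + dx3 3 4 5

/-- `α_(ii) = dx^{135} − dx^{146} − dx^{236} − dx^{245}`. -/
noncomputable def alphaII : AlternatingMap ℝ (Fin 6 → ℝ) ℝ (Fin 3) :=
  dx3 0 2 4 - dx3 0 3 5 - dx3 1 2 5 - dx3 1 3 4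

/-- `α_(iii) = dx^{156} − dx^{246} + dx^{345}`. -/
noncomputable def alphaIII : AlternatingMap ℝ (Fin 6 → ℝ) ℝ (Fin 3) :=
  dx3 0 4 5 - dx3 1 3 5 + dx3 2 3 4

/-- For `f : ℝ⁶ → ℝ`, the field of 3-forms
`ω^f_p = dx^{135} − dx^{146} − dx^{236} + f(p)·dx^{245}` on `ℝ⁶`. -/
noncomputable def omegaF (f : (Fin 6 → ℝ) → ℝ) (p : Fin 6 → ℝ) :
    AlternatingMap ℝ (Fin 6 → ℝ) ℝ (Fin 3) :=
  dx3 0 2 4 - dx3 0 3 5 - dx3 1 2 5 + f p • dx3 1 3 4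

theorem dx3_apply (i j k : Fin 6) (v : Fin 3 → Fin 6 → ℝ) :
    dx3 i j k v = v 0 i * v 1 j * v 2 k - v 0 i * v 1 k * v 2 j - v 0 j * v 1 i * v 2 k
      + v 0 j * v 1 k * v 2 i + v 0 k * v 1 i * v 2 j - v 0 k * v 1 j * v 2 i := by
  have h : dx3 i j k v = Matrix.det (Matrix.of fun a => v a ∘ ![i, j, k]) := rfl
  rw [h, Matrix.det_fin_three]
  simp

/-- The change of coordinates taking the form with coefficient `d ^ 2` to `alphaI`. -/
noncomputable def positiveEquiv (d : ℝ) (hd : d ≠ 0) : (Fin 6 → ℝ) ≃ₗ[ℝ] (Fin 6 → ℝ) where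
  toFun x := ![(x 0 + x 3) / 2, (x 0 - x 3) / (2 * d), (x 1 + x 4) / 2, (x 1 - x 4) / (2 * d),
    x 2 + x 5, d * (x 5 - x 2)]
  invFun y := ![y 0 + d * y 1, y 2 + d * y 3, (y 4 - y 5 / d) / 2, y 0 - d * y 1, y 2 - d * y 3,
    (y 4 + y 5 / d) / 2]
  map_add' x y := by ext i; fin_cases i <;> simp <;> ring
  map_smul' c x := by ext i; fin_cases i <;> simp <;> ring
  left_inv x := by ext i; fin_cases i <;> simp <;> field_simp <;> ring
  right_inv y := by ext i; fin_cases i <;> simp <;> field_simp <;> ring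

/-- The diagonal change of coordinates taking the form with coefficient `-d ^ 2` to `alphaII`. -/
noncomputable def negativeEquiv (d : ℝ) (hd : d ≠ 0) : (Fin 6 → ℝ) ≃ₗ[ℝ] (Fin 6 → ℝ) where
  toFun x := ![x 0, x 1 / d, x 2, x 3 / d, x 4, d * x 5]
  invFun y := ![y 0, d * y 1, y 2, d * y 3, y 4, y 5 / d]
  map_add' x y := by ext i; fin_cases i <;> simp <;> ring
  map_smul' c x := by ext i; fin_cases i <;> simp <;> ring
  left_inv x := by ext i; fin_cases i <;> simp <;> field_simp
  right_inv y := by ext i; fin_cases i <;> simp <;> field_simp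

/-- The signed permutation of coordinates taking the form with coefficient `0` to `alphaIII`. -/
def zeroEquiv : (Fin 6 → ℝ) ≃ₗ[ℝ] (Fin 6 → ℝ) where
  toFun x := ![x 4, -x 1, x 5, -x 2, x 0, x 3]
  invFun y := ![y 4, -y 1, -y 3, y 5, y 0, y 2]
  map_add' x y := by ext i; fin_cases i <;> simp <;> ring
  map_smul' c x := by ext i; fin_cases i <;> simp
  left_inv x := by ext i; fin_cases i <;> simp
  right_inv y := by ext i; fin_cases i <;> simp

/-- The linear type of `ω^f_p` is `α_(i)`, `α_(ii)` or `α_(iii)` according to the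
sign of `f(p)`. -/
theorem omegaF_linear_type (f : (Fin 6 → ℝ) → ℝ) (p : Fin 6 → ℝ) :
    (0 < f p → ∃ g : (Fin 6 → ℝ) ≃ₗ[ℝ] (Fin 6 → ℝ),
        (omegaF f p).compLinearMap (g : (Fin 6 → ℝ) →ₗ[ℝ] (Fin 6 → ℝ)) = alphaI) ∧
    (f p < 0 → ∃ g : (Fin 6 → ℝ) ≃ₗ[ℝ] (Fin 6 → ℝ),
        (omegaF f p).compLinearMap (g : (Fin 6 → ℝ) →ₗ[ℝ] (Fin 6 → ℝ)) = alphaII) ∧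
    (f p = 0 → ∃ g : (Fin 6 → ℝ) ≃ₗ[ℝ] (Fin 6 → ℝ),
        (omegaF f p).compLinearMap (g : (Fin 6 → ℝ) →ₗ[ℝ] (Fin 6 → ℝ)) = alphaIII) := by
  refine ⟨fun h => ?_, fun h => ?_, fun h => ?_⟩
  · obtain ⟨d, hd, hf⟩ : ∃ d : ℝ, d ≠ 0 ∧ f p = d ^ 2 :=
      ⟨√(f p), (Real.sqrt_pos.2 h).ne', (Real.sq_sqrt h.le).symm⟩
    refine ⟨positiveEquiv d hd, ?_⟩
    ext v
    simp [omegaF, alphaI, dx3_apply, positiveEquiv, hf]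
    field_simp
    ring
  · obtain ⟨d, hd, hf⟩ : ∃ d : ℝ, d ≠ 0 ∧ f p = -d ^ 2 :=
      ⟨√(-f p), (Real.sqrt_pos.2 (neg_pos.2 h)).ne', by
        rw [Real.sq_sqrt (neg_pos.2 h).le, neg_neg]⟩
    refine ⟨negativeEquiv d hd, ?_⟩
    ext v
    simp [omegaF, alphaII, dx3_apply, negativeEquiv, hf]
    field_simp
    ring
  · refine ⟨zeroEquiv, ?_⟩
    ext v
    simp [omegaF, alphaIII, dx3_apply, zeroEquiv, h]
    ring
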